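/- Let T be a bounded linear operator on a complex Hilbert space H and N an algebra norm on B(H). Then dw_N(T) ≥ (1/2) sqrt( (1/2) N(|T|² + |T*|²) + w_N(T)² + 2 N(|T|)⁴ + (d₁ + d₂) + 2|m₁ − m₂| ), where m₁ = max{N(Re T)² + N(|T|)⁴, w_N(T)²}, m₂ = max{N(Im T)², N(|T|)⁴}, d₁ = |N(Re T)² + N(|T|)⁴ − w_N(T)²|, d₂ = |N(Im T)² − N(|T|)⁴|. -/

import Mathlib

open ContinuousLinearMap Complex

variable {H : Type*} [NormedAddCommGroup H] [InnerProductSpace ℂ H] [CompleteSpace H]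

/-- Real part of an operator: `Re(A) = (A + A*)/2`. -/
noncomputable def reOp (A : H →L[ℂ] H) : H →L[ℂ] H := (2 : ℂ)⁻¹ • (A + adjoint A)

/-- Imaginary part of an operator: `Im(A) = (A - A*)/(2i)`. -/
noncomputable def imOp (A : H →L[ℂ] H) : H →L[ℂ] H := (2 * I)⁻¹ • (A - adjoint A)

/-- Modulus of an operator: `|A| = (A* A)^{1/2}`. -/
noncomputable def absOp (A : H →L[ℂ] H) : H →L[ℂ] H := CFC.sqrt (adjoint A * A)

/-- Generalized numerical radius. -/
noncomputable def wN (N : (H →L[ℂ] H) → ℝ) (T : H →L[ℂ] H) : ℝ :=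
  ⨆ θ : ℝ, N (reOp (Complex.exp (θ * I) • T))

/-- Generalized Davis–Wielandt radius. -/
noncomputable def dwN (N : (H →L[ℂ] H) → ℝ) (T : H →L[ℂ] H) : ℝ :=
  ⨆ θ : ℝ, Real.sqrt ((N (reOp (Complex.exp (θ * I) • T))) ^ 2
    + (N (reOp (Complex.exp (θ * I) • absOp T))) ^ 4)

lemma absOp_nonneg' (A : H →L[ℂ] H) : 0 ≤ absOp A := CFC.sqrt_nonneg _

lemma absOp_sq' (A : H →L[ℂ] H) : absOp A ^ 2 = adjoint A * A := by
  have h : 0 ≤ adjoint A * A := by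
    have := star_mul_self_nonneg A
    rwa [ContinuousLinearMap.star_eq_adjoint] at this
  exact CFC.sq_sqrt _ h

lemma adj_absOp (A : H →L[ℂ] H) : adjoint (absOp A) = absOp A := by
  have := (IsSelfAdjoint.of_nonneg (absOp_nonneg' A)).star_eq
  rwa [ContinuousLinearMap.star_eq_adjoint] at this

lemma reOp_absOp (A : H →L[ℂ] H) : reOp (absOp A) = absOp A := by
  unfold reOp
  rw [adj_absOp, ← two_smul ℂ, smul_smul]
  norm_num

lemma exp_neg_half_pi : Complex.exp (((-(Real.pi / 2) : ℝ) : ℂ) * I) = -I := by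
  rw [Complex.exp_mul_I, ← Complex.ofReal_cos, ← Complex.ofReal_sin]
  simp

lemma adj_smul' (c : ℂ) (A : H →L[ℂ] H) :
    adjoint (c • A) = (starRingEnd ℂ) c • adjoint A := map_smulₛₗ _ _ _

lemma reOp_negI (A : H →L[ℂ] H) : reOp ((-I) • A) = imOp A := by
  unfold reOp imOp
  rw [adj_smul']
  have : (2 * I)⁻¹ = (2 : ℂ)⁻¹ * (-I) := by
    rw [mul_inv, Complex.inv_I]
  rw [this, mul_smul]
  congr 1
  simp [sub_eq_add_neg]

lemma reOp_negI_absOp (A : H →L[ℂ] H) : reOp ((-I) • absOp A) = 0 := by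
  rw [reOp_negI, imOp, adj_absOp, sub_self, smul_zero]

lemma re_sq_add_im_sq (T : H →L[ℂ] H) :
    absOp T ^ 2 + absOp (adjoint T) ^ 2 = (2 : ℂ) • (reOp T * reOp T + imOp T * imOp T) := by
  rw [absOp_sq', absOp_sq', adjoint_adjoint]
  unfold reOp imOp
  have h1 : (2 : ℂ) * (2⁻¹ * 2⁻¹) = 2⁻¹ := by norm_num
  have h2 : (2 : ℂ) * ((2 * I)⁻¹ * (2 * I)⁻¹) = -2⁻¹ := by
    rw [mul_inv, Complex.inv_I]
    linear_combination (1 / 2 : ℂ) * Complex.I_mul_I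
  rw [smul_add, smul_mul_smul_comm, smul_mul_smul_comm, smul_smul, smul_smul, h1, h2]
  have h3 : ∀ X : H →L[ℂ] H, X = (2 : ℂ)⁻¹ • ((2 : ℂ) • X) := fun X => by
    rw [smul_smul]; norm_num
  rw [h3 (adjoint T * T + T * adjoint T), neg_smul, ← smul_neg, two_smul, ← smul_add]
  congr 1
  noncomm_ring

theorem stmt_12 (N : (H →L[ℂ] H) → ℝ) (T : H →L[ℂ] H)
    (hN0 : ∀ A : H →L[ℂ] H, 0 ≤ N A)
    (hNeq : ∀ A : H →L[ℂ] H, N A = 0 → A = 0)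
    (hNadd : ∀ A B : H →L[ℂ] H, N (A + B) ≤ N A + N B)
    (hNsmul : ∀ (c : ℂ) (A : H →L[ℂ] H), N (c • A) = ‖c‖ * N A)
    (hNmul : ∀ A B : H →L[ℂ] H, N (A * B) ≤ N A * N B)
    (m₁ m₂ d₁ d₂ : ℝ)
    (hm₁ : m₁ = max ((N (reOp T)) ^ 2 + (N (absOp T)) ^ 4) ((wN N T) ^ 2))
    (hm₂ : m₂ = max ((N (imOp T)) ^ 2) ((N (absOp T)) ^ 4))
    (hd₁ : d₁ = |(N (reOp T)) ^ 2 + (N (absOp T)) ^ 4 - (wN N T) ^ 2|)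
    (hd₂ : d₂ = |(N (imOp T)) ^ 2 - (N (absOp T)) ^ 4|) :
    dwN N T ≥ (1 / 2) * Real.sqrt ((1 / 2) * N (absOp T ^ 2 + absOp (adjoint T) ^ 2)
      + (wN N T) ^ 2 + 2 * (N (absOp T)) ^ 4 + (d₁ + d₂) + 2 * |m₁ - m₂|) := by
  have hN00 : N 0 = 0 := by simpa using hNsmul 0 0
  have hre : ∀ (θ : ℝ) (A : H →L[ℂ] H),
      N (reOp (Complex.exp (θ * I) • A)) ≤ N A + N (adjoint A) := by
    intro θ A
    unfold reOp
    rw [hNsmul, adj_smul']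
    have h := hNadd (Complex.exp (θ * I) • A)
      ((starRingEnd ℂ) (Complex.exp (θ * I)) • adjoint A)
    rw [hNsmul, hNsmul, RCLike.norm_conj, Complex.norm_exp_ofReal_mul_I] at h
    have h0 := hN0 (Complex.exp (θ * I) • A
      + (starRingEnd ℂ) (Complex.exp (θ * I)) • adjoint A)
    have : ‖(2 : ℂ)⁻¹‖ = 1 / 2 := by simp
    rw [this]
    linarith
  have hbd : BddAbove (Set.range fun θ : ℝ =>
      Real.sqrt ((N (reOp (Complex.exp (θ * I) • T))) ^ 2
        + (N (reOp (Complex.exp (θ * I) • absOp T))) ^ 4)) := by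
    refine ⟨Real.sqrt ((N T + N (adjoint T)) ^ 2
      + (N (absOp T) + N (adjoint (absOp T))) ^ 4), ?_⟩
    rintro _ ⟨θ, rfl⟩
    apply Real.sqrt_le_sqrt
    exact add_le_add (pow_le_pow_left₀ (hN0 _) (hre θ T) 2)
      (pow_le_pow_left₀ (hN0 _) (hre θ (absOp T)) 4)
  have hle := fun θ : ℝ => le_ciSup hbd θ
  have hD0 : 0 ≤ dwN N T := (Real.sqrt_nonneg _).trans (hle 0)
  have hsq : ∀ θ : ℝ, (N (reOp (Complex.exp (θ * I) • T))) ^ 2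
        + (N (reOp (Complex.exp (θ * I) • absOp T))) ^ 4 ≤ dwN N T ^ 2 := fun θ =>
    (Real.sqrt_le_left hD0).1 (hle θ)
  have ha : N (reOp T) ^ 2 + N (absOp T) ^ 4 ≤ dwN N T ^ 2 := by
    have := hsq 0
    simpa [reOp_absOp] using this
  have hb : N (imOp T) ^ 2 ≤ dwN N T ^ 2 := by
    have := hsq (-(Real.pi / 2))
    rw [exp_neg_half_pi, reOp_negI, reOp_negI_absOp, hN00] at this
    simpa using this
  have hw0 : 0 ≤ wN N T := Real.iSup_nonneg fun θ => hN0 _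
  have hw : wN N T ^ 2 ≤ dwN N T ^ 2 := by
    apply pow_le_pow_left₀ hw0
    apply ciSup_le
    intro θ
    refine le_trans (Real.le_sqrt_of_sq_le ?_) (hle θ)
    have := pow_nonneg (hN0 (reOp (Complex.exp (θ * I) • absOp T))) 4
    linarith
  have hsum : (1 / 2) * N (absOp T ^ 2 + absOp (adjoint T) ^ 2)
      ≤ N (reOp T) ^ 2 + N (imOp T) ^ 2 := by
    rw [re_sq_add_im_sq, hNsmul]
    have h1 := hNadd (reOp T * reOp T) (imOp T * imOp T)
    have h2 := hNmul (reOp T) (reOp T)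
    have h3 := hNmul (imOp T) (imOp T)
    have : ‖(2 : ℂ)‖ = 2 := by simp
    rw [this]
    nlinarith
  have hp : N (absOp T) ^ 4 ≤ dwN N T ^ 2 := by
    have := sq_nonneg (N (reOp T))
    linarith
  have e1 : 2 * m₁ = N (reOp T) ^ 2 + N (absOp T) ^ 4 + wN N T ^ 2 + d₁ := by
    rw [hm₁, hd₁, max_def_lt]
    split_ifs with h
    · rw [abs_of_neg (by linarith)]; ring
    · rw [abs_of_nonneg (by linarith)]; ring
  have e2 : 2 * m₂ = N (imOp T) ^ 2 + N (absOp T) ^ 4 + d₂ := by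
    rw [hm₂, hd₂, max_def_lt]
    split_ifs with h
    · rw [abs_of_neg (by linarith)]; ring
    · rw [abs_of_nonneg (by linarith)]; ring
  have l1 : m₁ ≤ dwN N T ^ 2 := hm₁ ▸ max_le ha hw
  have l2 : m₂ ≤ dwN N T ^ 2 := hm₂ ▸ max_le hb hp
  have key : |m₁ - m₂| ≤ 2 * dwN N T ^ 2 - m₁ - m₂ := by
    rw [abs_le]; constructor <;> linarith
  have fin : Real.sqrt ((1 / 2) * N (absOp T ^ 2 + absOp (adjoint T) ^ 2)
      + (wN N T) ^ 2 + 2 * (N (absOp T)) ^ 4 + (d₁ + d₂) + 2 * |m₁ - m₂|)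
      ≤ 2 * dwN N T := by
    apply Real.sqrt_le_iff.2
    constructor
    · linarith
    · nlinarith
  linarith
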